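/- Let f(s) = ∑_{n≥2} c_n n^{−s} be a Dirichlet series with zero constant term, nonnegative real coefficients c_n ≥ 0 (not all zero), converging absolutely in some half-plane, and with finite abscissa of absolute convergence σ_a^f > −∞. Fix w > 0 and let g be the unique Dirichlet series with zero constant term, absolutely convergent in some half-plane, satisfying f(s − w·g(s)) = g(s) for all Re(s) sufficiently large, and let σ_a^g be its abscissa of absolute convergence. If lim_{s→σ_a^f+} f′(s) < −1/w, then there is a unique s₀ > σ_a^f with f′(s₀) = −1/w and σ_a^g = s₀ + w·f(s₀); if lim_{s→σ_a^f+} f′(s) ≥ −1/w, then the series for f converges absolutely at s = σ_a^f and σ_a^g = σ_a^f + w·f(σ_a^f). -/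

import Mathlib

/-- The Dirichlet series `∑_{n} c n · n^{-s}` (as a `tsum`). -/
noncomputable def DSeries (c : ℕ → ℂ) (s : ℂ) : ℂ :=
  ∑' n : ℕ, c n * (n : ℂ) ^ (-s)

open scoped NNReal ENNReal

/-- the weight `m^{-σ}` as an extended nonnegative real -/
noncomputable def dT (σ : ℝ) (m : ℕ) : ℝ≥0∞ := ENNReal.ofReal ((m : ℝ) ^ (-σ))

/-- Dirichlet series with nonnegative coefficients, in `[0,∞]` -/
noncomputable def dE (A : ArithmeticFunction ℝ≥0) (σ : ℝ) : ℝ≥0∞ :=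
  ∑' m, (A m : ℝ≥0∞) * dT σ m

lemma dT_mul (σ : ℝ) (i j : ℕ) : dT σ (i * j) = dT σ i * dT σ j := by
  unfold dT
  rw [Nat.cast_mul, Real.mul_rpow (by positivity) (by positivity),
    ENNReal.ofReal_mul (by positivity)]

lemma dT_ne_top (σ : ℝ) (m : ℕ) : dT σ m ≠ ⊤ := ENNReal.ofReal_ne_top

lemma dT_ne_zero (σ : ℝ) {m : ℕ} (hm : m ≠ 0) : dT σ m ≠ 0 := by
  unfold dT
  rw [Ne, ENNReal.ofReal_eq_zero, not_le]
  positivity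

lemma dE_mul (A B : ArithmeticFunction ℝ≥0) (σ : ℝ) : dE (A * B) σ = dE A σ * dE B σ := by
  have h1 : dE A σ * dE B σ =
      ∑' p : ℕ × ℕ, ((A p.1 : ℝ≥0∞) * dT σ p.1) * ((B p.2 : ℝ≥0∞) * dT σ p.2) := by
    unfold dE
    rw [ENNReal.tsum_prod (f := fun i j : ℕ => ((A i : ℝ≥0∞) * dT σ i) * ((B j : ℝ≥0∞) * dT σ j)),
      ← ENNReal.tsum_mul_right]
    refine tsum_congr fun i => ?_
    rw [ENNReal.tsum_mul_left]
  rw [h1, ← ENNReal.tsum_fiberwise _ (fun p : ℕ × ℕ => p.1 * p.2)]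
  unfold dE
  refine tsum_congr fun m => ?_
  rcases eq_or_ne m 0 with rfl | hm
  · simp only [ArithmeticFunction.map_zero, ENNReal.coe_zero, zero_mul]
    symm
    rw [ENNReal.tsum_eq_zero]
    rintro ⟨⟨i, j⟩, h⟩
    have h' : i * j = 0 := h
    rcases Nat.mul_eq_zero.mp h' with rfl | rfl <;> simp
  · have : (fun p : ℕ × ℕ => p.1 * p.2) ⁻¹' {m} = ↑(m.divisorsAntidiagonal) := by
      ext p; simp [hm]
    rw [this, Finset.tsum_subtype' m.divisorsAntidiagonal
      (fun p : ℕ × ℕ => ((A p.1 : ℝ≥0∞) * dT σ p.1) * ((B p.2 : ℝ≥0∞) * dT σ p.2)),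
      ArithmeticFunction.mul_apply]
    push_cast
    rw [Finset.sum_mul]
    refine Finset.sum_congr rfl fun p hp => ?_
    rw [← (Nat.mem_divisorsAntidiagonal.mp hp).1, dT_mul]
    ring

lemma dE_one (σ : ℝ) : dE 1 σ = 1 := by
  unfold dE
  rw [tsum_eq_single 1]
  · simp [dT]
  · intro m hm
    simp [ArithmeticFunction.one_apply_ne hm]

lemma dE_pow (A : ArithmeticFunction ℝ≥0) (σ : ℝ) (k : ℕ) : dE (A ^ k) σ = dE A σ ^ k := by
  induction k with
  | zero => simp [dE_one]
  | succ k ih => rw [pow_succ, dE_mul, ih, pow_succ]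

/-- `c_n (w log n)^k / k!` -/
noncomputable def pK (C : ArithmeticFunction ℝ≥0) (w : ℝ≥0) (k : ℕ) : ArithmeticFunction ℝ≥0 :=
  ⟨fun n => C n * ((w * (Real.log n).toNNReal) ^ k / (k.factorial : ℝ≥0)), by simp⟩

lemma pK_apply (C : ArithmeticFunction ℝ≥0) (w : ℝ≥0) (k n : ℕ) :
    pK C w k n = C n * ((w * (Real.log n).toNNReal) ^ k / (k.factorial : ℝ≥0)) := rfl

lemma exp_tsum (y : ℝ) (hy : 0 ≤ y) :
    ∑' k : ℕ, ENNReal.ofReal (y ^ k / k.factorial) = ENNReal.ofReal (Real.exp y) := by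
  rw [← ENNReal.ofReal_tsum_of_nonneg (fun k => by positivity) (Real.summable_pow_div_factorial y),
    Real.exp_eq_exp_ℝ, NormedSpace.exp_eq_tsum_div]

lemma dE_series (C : ArithmeticFunction ℝ≥0) (w : ℝ≥0) (σ x : ℝ) (hx : 0 ≤ x) :
    ∑' k, dE (pK C w k) σ * (ENNReal.ofReal x) ^ k = dE C (σ - w * x) := by
  unfold dE
  simp_rw [← ENNReal.tsum_mul_right]
  rw [ENNReal.tsum_comm]
  refine tsum_congr fun n => ?_
  rcases eq_or_ne n 0 with rfl | hn
  · simp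
  have hl : 0 ≤ Real.log n := Real.log_natCast_nonneg n
  have h1 : ∀ k : ℕ, ((pK C w k n : ℝ≥0) : ℝ≥0∞) * dT σ n * ENNReal.ofReal x ^ k =
      ((C n : ℝ≥0∞) * dT σ n) * ENNReal.ofReal ((w * Real.log n * x) ^ k / k.factorial) := by
    intro k
    have h2 : ((pK C w k n : ℝ≥0) : ℝ≥0∞) =
        (C n : ℝ≥0∞) * ENNReal.ofReal ((w * Real.log n) ^ k / k.factorial) := by
      rw [pK_apply, ENNReal.coe_mul]
      congr 1
      rw [← ENNReal.ofReal_coe_nnreal]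
      congr 1
      push_cast
      rw [Real.coe_toNNReal _ hl]
    rw [h2, ← ENNReal.ofReal_pow hx]
    have h3 : (w * Real.log n * x) ^ k / k.factorial =
      ((w * Real.log n) ^ k / k.factorial) * x ^ k := by rw [mul_pow]; ring
    rw [h3, ENNReal.ofReal_mul (by positivity)]
    ring
  simp_rw [h1]
  rw [ENNReal.tsum_mul_left, exp_tsum _ (by positivity), mul_assoc]
  congr 1
  unfold dT
  rw [← ENNReal.ofReal_mul (by positivity)]
  congr 1
  have hn' : (0 : ℝ) < n := by positivity
  rw [Real.rpow_def_of_pos hn', Real.rpow_def_of_pos hn', ← Real.exp_add]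
  congr 1
  ring

/-- Dependence: `A^k` at `j ≤ N` depends only on `A` at `i ≤ N`. -/
lemma pow_congr {R : Type*} [Semiring R] (A B : ArithmeticFunction R) (N : ℕ)
    (h : ∀ i ≤ N, A i = B i) (k : ℕ) : ∀ j ≤ N, (A ^ k) j = (B ^ k) j := by
  induction k with
  | zero => intros; simp
  | succ k ih =>
    intro j hj
    rw [pow_succ, pow_succ, ArithmeticFunction.mul_apply, ArithmeticFunction.mul_apply]
    refine Finset.sum_congr rfl fun p hp => ?_
    have hp' := Nat.mem_divisorsAntidiagonal.mp hp
    have h1 : p.1 ≤ N := (Nat.le_of_dvd (Nat.pos_of_ne_zero hp'.2) ⟨p.2, hp'.1.symm⟩).trans hj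
    have h2 : p.2 ≤ N := (Nat.le_of_dvd (Nat.pos_of_ne_zero hp'.2)
      ⟨p.1, by rw [mul_comm]; exact hp'.1.symm⟩).trans hj
    rw [ih _ h1, h _ h2]

lemma fst_snd_lt {m : ℕ} {p : ℕ × ℕ} (hp : p ∈ m.divisorsAntidiagonal) (h1 : p.1 ≠ 1) :
    p.2 < m := by
  have hp' := Nat.mem_divisorsAntidiagonal.mp hp
  have a1 : p.1 ≠ 0 := by rintro h; exact hp'.2 (by rw [← hp'.1, h, zero_mul])
  have a2 : p.2 ≠ 0 := by rintro h; exact hp'.2 (by rw [← hp'.1, h, mul_zero])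
  rw [← hp'.1]
  have : 2 ≤ p.1 := by omega
  nlinarith [Nat.pos_of_ne_zero a2]

/-- forward inequality -/
lemma dE_le_of (C β : ArithmeticFunction ℝ≥0) (w : ℝ≥0) (hC1 : C 1 = 0)
    (hβ : ∀ m, (β m : ℝ≥0∞) = ∑' k, ((pK C w k * β ^ k) m : ℝ≥0∞))
    (σ x : ℝ) (hx : 0 ≤ x) (h : dE C (σ - w * x) ≤ ENNReal.ofReal x) :
    dE β σ ≤ ENNReal.ofReal x := by
  let βN : ℕ → ArithmeticFunction ℝ≥0 := fun N => ⟨fun m => if m ≤ N then β m else 0, by simp⟩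
  have hβN : ∀ N m, βN N m = if m ≤ N then β m else 0 := fun _ _ => rfl
  have key : ∀ N, dE (βN N) σ ≤ ENNReal.ofReal x := by
    intro N
    induction N with
    | zero =>
      have : dE (βN 0) σ = 0 := by
        unfold dE
        rw [ENNReal.tsum_eq_zero]
        intro m
        rw [hβN]
        split_ifs with hm
        · obtain rfl : m = 0 := by omega
          simp
        · simp
      rw [this]; exact zero_le
    | succ N ih =>
      calc dE (βN (N + 1)) σ ≤ ∑' k, dE (pK C w k * (βN N) ^ k) σ := by
            unfold dE
            rw [ENNReal.tsum_comm]
            refine ENNReal.tsum_le_tsum fun m => ?_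
            rw [ENNReal.tsum_mul_right]
            gcongr
            rw [hβN]
            split_ifs with hm
            · rw [hβ]
              refine ENNReal.tsum_le_tsum fun k => ?_
              refine ENNReal.coe_le_coe.mpr (le_of_eq ?_)
              rw [ArithmeticFunction.mul_apply, ArithmeticFunction.mul_apply]
              refine Finset.sum_congr rfl fun p hp => ?_
              by_cases h1 : p.1 = 1
              · rw [pK_apply, h1, hC1]; simp
              · congr 1
                have := fst_snd_lt hp h1
                refine pow_congr β (βN N) N (fun i hi => ?_) k _ (by omega)
                rw [hβN, if_pos hi]
            · simp
        _ = ∑' k, dE (pK C w k) σ * dE (βN N) σ ^ k := by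
            simp_rw [dE_mul, dE_pow]
        _ ≤ ∑' k, dE (pK C w k) σ * ENNReal.ofReal x ^ k := by
            refine ENNReal.tsum_le_tsum fun k => ?_
            gcongr
        _ = dE C (σ - w * x) := dE_series C w σ x hx
        _ ≤ _ := h
  unfold dE
  rw [ENNReal.tsum_eq_iSup_nat]
  refine iSup_le fun N => ?_
  refine le_trans ?_ (key N)
  unfold dE
  refine le_trans (Finset.sum_le_sum fun m hm => ?_) (ENNReal.sum_le_tsum (Finset.range N))
  rw [hβN, if_pos (Finset.mem_range.mp hm).le]

/-- functional equation in `[0,∞]` -/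
lemma dE_eq_of (C β : ArithmeticFunction ℝ≥0) (w : ℝ≥0)
    (hβ : ∀ m, (β m : ℝ≥0∞) = ∑' k, ((pK C w k * β ^ k) m : ℝ≥0∞))
    (σ : ℝ) (h : dE β σ ≠ ⊤) :
    dE C (σ - w * (dE β σ).toReal) = dE β σ := by
  rw [← dE_series C w σ _ ENNReal.toReal_nonneg, ENNReal.ofReal_toReal h]
  simp_rw [← dE_pow, ← dE_mul]
  unfold dE
  rw [ENNReal.tsum_comm]
  refine tsum_congr fun m => ?_
  rw [ENNReal.tsum_mul_right, hβ]

lemma dT_anti {σ τ : ℝ} (h : σ ≤ τ) {m : ℕ} (hm : m ≠ 0) : dT τ m ≤ dT σ m := by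
  unfold dT
  refine ENNReal.ofReal_le_ofReal (Real.rpow_le_rpow_of_exponent_le ?_ (by linarith))
  exact_mod_cast Nat.one_le_iff_ne_zero.mpr hm

lemma dE_anti (A : ArithmeticFunction ℝ≥0) {σ τ : ℝ} (h : σ ≤ τ) : dE A τ ≤ dE A σ := by
  unfold dE
  refine ENNReal.tsum_le_tsum fun m => ?_
  rcases eq_or_ne m 0 with rfl | hm
  · simp
  · gcongr
    exact dT_anti h hm

/-- absolute value of an arithmetic function -/
noncomputable def absA (b : ArithmeticFunction ℂ) : ArithmeticFunction ℝ≥0 :=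
  ⟨fun n => ‖b n‖₊, by simp⟩

lemma absA_apply (b : ArithmeticFunction ℂ) (n : ℕ) : absA b n = ‖b n‖₊ := rfl

/-- coercion of an arithmetic function -/
noncomputable def toC (A : ArithmeticFunction ℝ≥0) : ArithmeticFunction ℂ :=
  ⟨fun n => ((A n : ℝ) : ℂ), by simp⟩

lemma toC_apply (A : ArithmeticFunction ℝ≥0) (n : ℕ) : toC A n = ((A n : ℝ) : ℂ) := rfl

lemma absA_mul_le (a b : ArithmeticFunction ℂ) (m : ℕ) : absA (a * b) m ≤ (absA a * absA b) m := by
  rw [absA_apply, ArithmeticFunction.mul_apply, ArithmeticFunction.mul_apply]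
  refine (nnnorm_sum_le _ _).trans (le_of_eq ?_)
  refine Finset.sum_congr rfl fun p _ => ?_
  rw [nnnorm_mul]; rfl

lemma mul_mono_af {A A' B B' : ArithmeticFunction ℝ≥0} (h : ∀ m, A m ≤ A' m)
    (h' : ∀ m, B m ≤ B' m) (m : ℕ) : (A * B) m ≤ (A' * B') m := by
  rw [ArithmeticFunction.mul_apply, ArithmeticFunction.mul_apply]
  exact Finset.sum_le_sum fun p _ => mul_le_mul' (h _) (h' _)

lemma absA_pow_le (b : ArithmeticFunction ℂ) (k m : ℕ) : absA (b ^ k) m ≤ (absA b ^ k) m := by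
  induction k generalizing m with
  | zero =>
    rw [absA_apply, pow_zero, pow_zero]
    by_cases h : m = 1
    · simp [h]
    · simp [ArithmeticFunction.one_apply_ne h]
  | succ k ih =>
    rw [pow_succ, pow_succ]
    exact (absA_mul_le _ _ m).trans (mul_mono_af ih (fun _ => le_rfl) m)

lemma absA_toC (A : ArithmeticFunction ℝ≥0) : absA (toC A) = A := by
  ext n
  simp [absA_apply, toC_apply]

lemma enorm_term (a : ArithmeticFunction ℂ) (x : ℝ) (m : ℕ) :
    ‖LSeries.term a x m‖ₑ = (absA a m : ℝ≥0∞) * dT x m := by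
  rcases eq_or_ne m 0 with rfl | hm
  · simp
  rw [LSeries.term_def₀ (by simp), enorm_mul]
  congr 1
  rw [← ofReal_norm, dT]
  congr 1
  have := Complex.norm_natCast_cpow_of_pos (Nat.pos_of_ne_zero hm) (-(x:ℂ))
  rw [this]; simp

lemma tsum_enorm_term (a : ArithmeticFunction ℂ) (x : ℝ) :
    ∑' m, ‖LSeries.term a x m‖ₑ = dE (absA a) x := by
  unfold dE
  exact tsum_congr fun m => enorm_term a x m

lemma dE_mono {A B : ArithmeticFunction ℝ≥0} (h : ∀ m, A m ≤ B m) (x : ℝ) : dE A x ≤ dE B x := by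
  unfold dE
  refine ENNReal.tsum_le_tsum fun m => ?_
  gcongr
  exact h m

lemma summable_of_dE {a : ArithmeticFunction ℂ} {x : ℝ} (h : dE (absA a) x ≠ ⊤) :
    LSeriesSummable a x :=
  Summable.of_enorm (by rwa [tsum_enorm_term])

lemma DSeries_eq (a : ArithmeticFunction ℂ) (s : ℂ) : DSeries a s = LSeries a s := by
  unfold DSeries LSeries
  exact tsum_congr fun n => (LSeries.term_def₀ (by simp) s n).symm

lemma LSeries_pow {b : ArithmeticFunction ℂ} {s : ℂ} (h : LSeriesSummable b s) (k : ℕ) :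
    LSeriesSummable (b ^ k : ArithmeticFunction ℂ) s ∧
      LSeries (b ^ k : ArithmeticFunction ℂ) s = LSeries b s ^ k := by
  induction k with
  | zero =>
    have h1 : ∀ n, LSeries.term (1 : ArithmeticFunction ℂ) s n = if n = 1 then 1 else 0 := by
      intro n
      rw [LSeries.term_def₀ (by simp)]
      split_ifs with hn
      · simp [hn]
      · simp [ArithmeticFunction.one_apply_ne hn]
    have h2 : HasSum (LSeries.term (1 : ArithmeticFunction ℂ) s) 1 := by
      rw [funext h1]
      exact hasSum_ite_eq 1 1
    rw [pow_zero, pow_zero]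
    exact ⟨h2.summable, h2.tsum_eq⟩
  | succ k ih =>
    rw [pow_succ, pow_succ]
    exact ⟨ArithmeticFunction.LSeriesSummable_mul ih.1 h, by
      rw [ArithmeticFunction.LSeries_mul' ih.1 h, ih.2]⟩

lemma compose_eq (C : ArithmeticFunction ℝ≥0) (w : ℝ≥0) (x X : ℝ) (G : ℂ) (hX : 0 ≤ X)
    (hG : ‖G‖ₑ ≤ ENNReal.ofReal X) (hfin : dE C (x - w * X) ≠ ⊤) :
    ∑' k, LSeries (toC (pK C w k)) x * G ^ k = DSeries (toC C) (x - w * G) := by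
  have hs : Summable (Function.uncurry fun (k n : ℕ) => LSeries.term (toC (pK C w k)) x n * G ^ k) := by
    refine Summable.of_enorm (ne_top_of_le_ne_top hfin ?_)
    simp only [Function.uncurry_def]
    rw [← dE_series C w x X hX,
      ENNReal.tsum_prod (f := fun k n : ℕ => ‖LSeries.term (toC (pK C w k)) x n * G ^ k‖ₑ)]
    refine ENNReal.tsum_le_tsum fun k => ?_
    simp_rw [enorm_mul, ENNReal.tsum_mul_right, tsum_enorm_term, absA_toC, enorm_pow]
    gcongr
  unfold LSeries
  simp_rw [← tsum_mul_right]
  rw [← hs.tsum_comm]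
  unfold DSeries
  refine tsum_congr fun n => ?_
  rcases eq_or_ne n 0 with rfl | hn
  · simp
  have hl : 0 ≤ Real.log n := Real.log_natCast_nonneg n
  have h1 : ∀ k : ℕ, LSeries.term (toC (pK C w k)) x n * G ^ k =
      toC C n * (n : ℂ) ^ (-(x : ℂ)) * ((w * Real.log n * G) ^ k / k.factorial) := by
    intro k
    rw [LSeries.term_def₀ (by simp), toC_apply, toC_apply, pK_apply]
    push_cast
    rw [Real.coe_toNNReal _ hl, Complex.natCast_log, mul_pow _ G]
    ring
  simp_rw [h1]
  rw [tsum_mul_left, ← congrFun (NormedSpace.exp_eq_tsum_div (𝔸 := ℂ)) _, ← Complex.exp_eq_exp_ℂ,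
    mul_assoc]
  congr 1
  have hn' : (n : ℂ) ≠ 0 := by exact_mod_cast hn
  rw [Complex.cpow_def_of_ne_zero hn', Complex.cpow_def_of_ne_zero hn', ← Complex.exp_add,
    Complex.ofReal_log (by positivity)]
  congr 1
  push_cast
  ring

lemma coeff_id (C : ArithmeticFunction ℝ≥0) (w : ℝ≥0) (b : ArithmeticFunction ℂ)
    (σ₀ σ₁ : ℝ) (hσ₀ : dE (absA b) σ₀ ≠ ⊤) (hσ₁ : dE C σ₁ ≠ ⊤)
    (heq : ∃ θ : ℝ, ∀ s : ℂ, θ < s.re → DSeries (toC C) (s - w * DSeries b s) = DSeries b s) :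
    (∀ m, ∑' k, ((pK C w k * absA b ^ k) m : ℝ≥0∞) ≠ ⊤) ∧
    ∀ m, b m = ∑' k, (toC (pK C w k) * b ^ k) m := by
  obtain ⟨θ, heq⟩ := heq
  set X : ℝ := (dE (absA b) σ₀).toReal + 1 with hXdef
  have hX1 : 1 ≤ X := by
    have : 0 ≤ (dE (absA b) σ₀).toReal := ENNReal.toReal_nonneg
    linarith
  have hX : 0 ≤ X := by linarith
  set x₀ : ℝ := max σ₀ (σ₁ + w * X)
  have hbX : ∀ x, x₀ ≤ x → dE (absA b) x ≤ ENNReal.ofReal X := by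
    intro x hx
    refine (dE_anti _ ((le_max_left _ _).trans hx)).trans ?_
    rw [← ENNReal.ofReal_toReal hσ₀]
    exact ENNReal.ofReal_le_ofReal (by linarith)
  have hfin : ∀ x, x₀ ≤ x → dE C (x - w * X) ≠ ⊤ := by
    intro x hx
    refine ne_top_of_le_ne_top hσ₁ (dE_anti _ ?_)
    have := (le_max_right _ _).trans hx
    linarith
  have hdbl : ∀ x, x₀ ≤ x → ∑' k, dE (pK C w k * absA b ^ k) x ≠ ⊤ := by
    intro x hx
    refine ne_top_of_le_ne_top (hfin x hx) ?_
    rw [← dE_series C w x X hX]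
    refine ENNReal.tsum_le_tsum fun k => ?_
    rw [dE_mul, dE_pow]
    gcongr
    exact hbX x hx
  have hpk : ∀ x, x₀ ≤ x → ∀ k, dE (pK C w k) x ≠ ⊤ := by
    intro x hx k
    refine ne_top_of_le_ne_top (hfin x hx) ?_
    rw [← dE_series C w x X hX]
    refine le_trans ?_ (ENNReal.le_tsum k)
    refine le_mul_of_one_le_right' (one_le_pow₀ ?_)
    rw [← ENNReal.ofReal_one]
    exact ENNReal.ofReal_le_ofReal hX1
  have hA : ∀ m, ∑' k, ((pK C w k * absA b ^ k) m : ℝ≥0∞) ≠ ⊤ := by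
    intro m
    rcases eq_or_ne m 0 with rfl | hm
    · simp
    intro htop
    refine hdbl x₀ le_rfl ?_
    unfold dE
    rw [ENNReal.tsum_comm]
    refine ENNReal.tsum_eq_top_of_eq_top ⟨m, ?_⟩
    rw [ENNReal.tsum_mul_right, htop]
    exact ENNReal.top_mul (dT_ne_zero _ hm)
  refine ⟨hA, ?_⟩
  have hle : ∀ k m, absA (toC (pK C w k) * b ^ k) m ≤ (pK C w k * absA b ^ k) m := by
    intro k m
    refine (absA_mul_le _ _ m).trans (mul_mono_af ?_ (absA_pow_le b k) m)
    rw [absA_toC]; exact fun _ => le_rfl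
  let a : ArithmeticFunction ℂ := ⟨fun m => ∑' k, (toC (pK C w k) * b ^ k) m, by simp⟩
  have ha : ∀ m, a m = ∑' k, (toC (pK C w k) * b ^ k) m := fun _ => rfl
  have hale : ∀ m, (absA a m : ℝ≥0∞) ≤ ∑' k, ((pK C w k * absA b ^ k) m : ℝ≥0∞) := by
    intro m
    have : (absA a m : ℝ≥0∞) = ‖a m‖ₑ := rfl
    rw [this, ha]
    refine enorm_tsum_le_tsum_enorm.trans (ENNReal.tsum_le_tsum fun k => ?_)
    exact ENNReal.coe_le_coe.mpr (hle k m)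
  have hasum : ∀ x, x₀ ≤ x → dE (absA a) x ≠ ⊤ := by
    intro x hx
    refine ne_top_of_le_ne_top (hdbl x hx) ?_
    unfold dE
    rw [ENNReal.tsum_comm]
    refine ENNReal.tsum_le_tsum fun m => ?_
    rw [ENNReal.tsum_mul_right]
    gcongr
    exact hale m
  have hbsum : ∀ x, x₀ ≤ x → LSeriesSummable b x := fun x hx =>
    summable_of_dE (ne_top_of_le_ne_top ENNReal.ofReal_ne_top (hbX x hx))
  have hLa : ∀ x : ℝ, x₀ ≤ x → LSeries a x = DSeries (toC C) (x - w * LSeries b x) := by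
    intro x hx
    have hG : ‖LSeries b x‖ₑ ≤ ENNReal.ofReal X := by
      refine le_trans enorm_tsum_le_tsum_enorm ?_
      rw [tsum_enorm_term]
      exact hbX x hx
    rw [← compose_eq C w x X _ hX hG (hfin x hx)]
    have h1 : ∀ k, LSeries (toC (pK C w k)) x * LSeries b x ^ k =
        LSeries (toC (pK C w k) * b ^ k : ArithmeticFunction ℂ) x := by
      intro k
      rw [ArithmeticFunction.LSeries_mul' (summable_of_dE (by rw [absA_toC]; exact hpk x hx k))
        (LSeries_pow (hbsum x hx) k).1, (LSeries_pow (hbsum x hx) k).2]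
    simp_rw [h1]
    have hs : Summable (Function.uncurry fun (k n : ℕ) =>
        LSeries.term (toC (pK C w k) * b ^ k : ArithmeticFunction ℂ) x n) := by
      refine Summable.of_enorm (ne_top_of_le_ne_top (hdbl x hx) ?_)
      simp only [Function.uncurry_def]
      rw [ENNReal.tsum_prod (f := fun k n : ℕ =>
        ‖LSeries.term (toC (pK C w k) * b ^ k : ArithmeticFunction ℂ) x n‖ₑ)]
      refine ENNReal.tsum_le_tsum fun k => ?_
      rw [tsum_enorm_term]
      exact dE_mono (hle k) x
    unfold LSeries
    rw [← hs.tsum_comm]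
    refine tsum_congr fun m => ?_
    rw [LSeries.term_def₀ (by simp), ha, ← tsum_mul_right]
    refine tsum_congr fun k => ?_
    rw [LSeries.term_def₀ (by simp)]
  intro m
  rcases eq_or_ne m 0 with rfl | hm
  · simp
  rw [← ha]
  refine LSeries.eq_of_LSeries_eventually_eq (f := b) (g := a) ?_ ?_ ?_ hm
  · exact (hbsum x₀ le_rfl).abscissaOfAbsConv_le.trans_lt (EReal.coe_lt_top _)
  · exact (summable_of_dE (hasum x₀ le_rfl)).abscissaOfAbsConv_le.trans_lt (EReal.coe_lt_top _)
  · filter_upwards [Filter.eventually_ge_atTop x₀, Filter.eventually_gt_atTop θ] with x hx hx'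
    rw [hLa x hx, ← DSeries_eq b, heq x (by simpa using hx')]

lemma nonneg_id (C : ArithmeticFunction ℝ≥0) (w : ℝ≥0) (b : ArithmeticFunction ℂ) (hC1 : C 1 = 0)
    (hA : ∀ m, ∑' k, ((pK C w k * absA b ^ k) m : ℝ≥0∞) ≠ ⊤)
    (hb : ∀ m, b m = ∑' k, (toC (pK C w k) * b ^ k) m) :
    ∀ m, (absA b m : ℝ≥0∞) = ∑' k, ((pK C w k * absA b ^ k) m : ℝ≥0∞) := by
  have toC_mul : ∀ A B : ArithmeticFunction ℝ≥0, toC (A * B) = toC A * toC B := by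
    intro A B
    ext n
    rw [toC_apply, ArithmeticFunction.mul_apply, ArithmeticFunction.mul_apply]
    push_cast
    rfl
  have toC_pow : ∀ (A : ArithmeticFunction ℝ≥0) (k : ℕ), toC (A ^ k) = toC A ^ k := by
    intro A k
    induction k with
    | zero =>
      ext n
      rw [pow_zero, pow_zero, toC_apply]
      by_cases h : n = 1
      · simp [h]
      · simp [ArithmeticFunction.one_apply_ne h]
    | succ k ih => rw [pow_succ, pow_succ, toC_mul, ih]
  have main : ∀ m, (∀ i < m, b i = toC (absA b) i) →
      b m = (((∑' k, (pK C w k * absA b ^ k) m : ℝ≥0) : ℝ) : ℂ) := by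
    intro m hm
    rw [hb m, NNReal.coe_tsum, Complex.ofReal_tsum]
    refine tsum_congr fun k => ?_
    rw [← toC_apply, toC_mul, toC_pow, ArithmeticFunction.mul_apply, ArithmeticFunction.mul_apply]
    refine Finset.sum_congr rfl fun p hp => ?_
    by_cases h1 : p.1 = 1
    · rw [toC_apply, pK_apply, h1, hC1]; simp
    · congr 1
      have := fst_snd_lt hp h1
      exact pow_congr b (toC (absA b)) p.2 (fun i hi => hm i (by omega)) k _ le_rfl
  have hbb : ∀ m, b m = toC (absA b) m := by
    intro m
    induction m using Nat.strong_induction_on with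
    | _ m ih =>
      have := main m ih
      rw [toC_apply, absA_apply, this]
      simp
  intro m
  rw [← ENNReal.coe_tsum (ENNReal.tsum_coe_ne_top_iff_summable.mp (hA m))]
  congr 1
  rw [absA_apply, main m (fun i _ => hbb i)]
  simp

lemma dE_ne_top_iff (A : ArithmeticFunction ℝ≥0) (σ : ℝ) :
    dE A σ ≠ ⊤ ↔ Summable fun n : ℕ => (A n : ℝ) * (n : ℝ) ^ (-σ) := by
  have h : dE A σ = ∑' n : ℕ, ENNReal.ofReal ((A n : ℝ) * (n : ℝ) ^ (-σ)) := by
    unfold dE dT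
    refine tsum_congr fun n => ?_
    rw [ENNReal.ofReal_mul (by positivity), ENNReal.ofReal_coe_nnreal]
  rw [h]
  constructor
  · intro h'
    have := ENNReal.summable_toReal h'
    refine this.congr fun n => ?_
    rw [ENNReal.toReal_ofReal (by positivity)]
  · intro h'
    exact h'.tsum_ofReal_ne_top

lemma dE_toReal (A : ArithmeticFunction ℝ≥0) (σ : ℝ) :
    (dE A σ).toReal = ∑' n : ℕ, (A n : ℝ) * (n : ℝ) ^ (-σ) := by
  unfold dE dT
  rw [ENNReal.tsum_toReal_eq (fun n => ENNReal.mul_ne_top ENNReal.coe_ne_top ENNReal.ofReal_ne_top)]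
  refine tsum_congr fun n => ?_
  rw [ENNReal.toReal_mul, ENNReal.toReal_ofReal (by positivity), ENNReal.coe_toReal]

lemma Sg_eq (c : ℕ → ℝ) (hc0 : c 0 = 0) (hc1 : c 1 = 0) (hcpos : ∀ n, 0 ≤ c n)
    (hfconv : {σ : ℝ | Summable fun n : ℕ => c n * (n : ℝ) ^ (-σ)}.Nonempty)
    (w : ℝ) (hw : 0 < w) (b : ℕ → ℂ) (hb0 : b 0 = 0)
    (hgconv : ∃ θ : ℝ, ∀ s : ℂ, θ < s.re → Summable fun n : ℕ => ‖b n * (n : ℂ) ^ (-s)‖)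
    (heq : ∃ θ : ℝ, ∀ s : ℂ, θ < s.re →
      DSeries (fun n => (c n : ℂ)) (s - (w : ℂ) * DSeries b s) = DSeries b s) (σ : ℝ) :
    (Summable fun n : ℕ => ‖b n‖ * (n : ℝ) ^ (-σ)) ↔
      ∃ u, (Summable fun n : ℕ => c n * (n : ℝ) ^ (-u)) ∧
        u + w * ∑' n : ℕ, c n * (n : ℝ) ^ (-u) ≤ σ := by
  let C : ArithmeticFunction ℝ≥0 := ⟨fun n => ⟨c n, hcpos n⟩, by ext; exact hc0⟩
  let B : ArithmeticFunction ℂ := ⟨b, hb0⟩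
  have hC : ∀ n, (C n : ℝ) = c n := fun _ => rfl
  have hB : ∀ n, (absA B n : ℝ) = ‖b n‖ := fun _ => rfl
  lift w to ℝ≥0 using hw.le
  have hfC : ∀ u, dE C u ≠ ⊤ ↔ Summable fun n : ℕ => c n * (n : ℝ) ^ (-u) := fun u =>
    dE_ne_top_iff C u
  have hgB : ∀ u, dE (absA B) u ≠ ⊤ ↔ Summable fun n : ℕ => ‖b n‖ * (n : ℝ) ^ (-u) := fun u =>
    dE_ne_top_iff (absA B) u
  have hCr : ∀ u, (dE C u).toReal = ∑' n : ℕ, c n * (n : ℝ) ^ (-u) := fun u => dE_toReal C u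
  have hC1 : C 1 = 0 := by ext; exact hc1
  obtain ⟨σ₁, hσ₁⟩ := hfconv
  obtain ⟨θ, hθ⟩ := hgconv
  have hσ₀ : dE (absA B) (θ + 1) ≠ ⊤ := by
    rw [hgB]
    refine (hθ ((θ + 1 : ℝ) : ℂ) (by simp)).congr fun n => ?_
    rcases eq_or_ne n 0 with rfl | hn
    · simp [hb0]
    rw [norm_mul]
    congr 1
    rw [Complex.norm_natCast_cpow_of_pos (Nat.pos_of_ne_zero hn)]
    simp
  obtain ⟨h1, h2⟩ := coeff_id C w B (θ + 1) σ₁ hσ₀ ((hfC σ₁).mpr hσ₁) heq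
  have h3 := nonneg_id C w B hC1 h1 h2
  rw [← hgB]
  simp_rw [← hfC, ← hCr]
  constructor
  · intro h
    have h4 := dE_eq_of C (absA B) w h3 σ h
    refine ⟨_, by rw [h4]; exact h, ?_⟩
    rw [h4]
    linarith
  · rintro ⟨u, hu, hle⟩
    have hw0 : (w : ℝ) ≠ 0 := hw.ne'
    have hx : (dE C u).toReal ≤ (σ - u) / w := by
      rw [le_div_iff₀ hw]; linarith
    have hu' : σ - w * ((σ - u) / w) = u := by field_simp; ring
    refine ne_top_of_le_ne_top ENNReal.ofReal_ne_top (dE_le_of C (absA B) w hC1 h3 σ ((σ - u) / w)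
      (ENNReal.toReal_nonneg.trans hx) ?_)
    rw [hu', ← ENNReal.ofReal_toReal hu]
    exact ENNReal.ofReal_le_ofReal hx

/-- tangent inequality for one term -/
lemma term_tangent (n : ℕ) (hn : n ≠ 0) (s u : ℝ) :
    (n : ℝ) ^ (-s) - Real.log n * (n : ℝ) ^ (-s) * (u - s) ≤ (n : ℝ) ^ (-u) := by
  have hn' : (0 : ℝ) < n := by positivity
  have h : (n : ℝ) ^ (-u) = (n : ℝ) ^ (-s) * Real.exp (-(Real.log n * (u - s))) := by
    rw [Real.rpow_def_of_pos hn', Real.rpow_def_of_pos hn', ← Real.exp_add]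
    congr 1; ring
  rw [h]
  have h1 := Real.add_one_le_exp (-(Real.log n * (u - s)))
  have h2 : 0 < (n : ℝ) ^ (-s) := by positivity
  nlinarith

lemma tangent (c : ℕ → ℝ) (hc0 : c 0 = 0) (hcpos : ∀ n, 0 ≤ c n) (s u : ℝ)
    (h1 : Summable fun n : ℕ => c n * (n : ℝ) ^ (-s))
    (h2 : Summable fun n : ℕ => c n * Real.log n * (n : ℝ) ^ (-s))
    (h3 : Summable fun n : ℕ => c n * (n : ℝ) ^ (-u)) :
    (∑' n : ℕ, c n * (n : ℝ) ^ (-s)) - (∑' n : ℕ, c n * Real.log n * (n : ℝ) ^ (-s)) * (u - s) ≤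
      ∑' n : ℕ, c n * (n : ℝ) ^ (-u) := by
  rw [← tsum_mul_right, ← h1.tsum_sub (h2.mul_right _)]
  refine (h1.sub (h2.mul_right _)).tsum_le_tsum (fun n => ?_) h3
  rcases eq_or_ne n 0 with rfl | hn
  · simp [hc0]
  have := mul_le_mul_of_nonneg_left (term_tangent n hn s u) (hcpos n)
  calc _ = c n * ((n : ℝ) ^ (-s) - Real.log n * (n : ℝ) ^ (-s) * (u - s)) := by ring
    _ ≤ _ := this

lemma summable_up (c : ℕ → ℝ) (hc0 : c 0 = 0) (hcpos : ∀ n, 0 ≤ c n) {s u : ℝ} (hsu : s ≤ u)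
    (h1 : Summable fun n : ℕ => c n * (n : ℝ) ^ (-s)) :
    Summable fun n : ℕ => c n * (n : ℝ) ^ (-u) := by
  refine Summable.of_nonneg_of_le (fun n => mul_nonneg (hcpos n) (by positivity)) (fun n => ?_) h1
  rcases eq_or_ne n 0 with rfl | hn
  · simp [hc0]
  refine mul_le_mul_of_nonneg_left ?_ (hcpos n)
  refine Real.rpow_le_rpow_of_exponent_le ?_ (by linarith)
  exact_mod_cast Nat.one_le_iff_ne_zero.mpr hn

lemma summable_log (c : ℕ → ℝ) (hc0 : c 0 = 0) (hcpos : ∀ n, 0 ≤ c n) {s u : ℝ} (hsu : s < u)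
    (h1 : Summable fun n : ℕ => c n * (n : ℝ) ^ (-s)) :
    Summable fun n : ℕ => c n * Real.log n * (n : ℝ) ^ (-u) := by
  refine Summable.of_nonneg_of_le (fun n => mul_nonneg (mul_nonneg (hcpos n)
    (Real.log_natCast_nonneg n)) (by positivity)) (fun n => ?_) (h1.mul_right (1 / (u - s)))
  rcases eq_or_ne n 0 with rfl | hn
  · simp [hc0]
  have hn' : (0 : ℝ) < n := by positivity
  have h := Real.log_le_rpow_div hn'.le (sub_pos.mpr hsu)
  have e : (n : ℝ) ^ (-s) = (n : ℝ) ^ (u - s) * (n : ℝ) ^ (-u) := by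
    rw [← Real.rpow_add hn']; congr 1; ring
  calc c n * Real.log n * (n : ℝ) ^ (-u) ≤ c n * ((n : ℝ) ^ (u - s) / (u - s)) * (n : ℝ) ^ (-u) := by
        gcongr
        exact hcpos n
    _ = _ := by rw [e]; ring

theorem stmt_19 (c : ℕ → ℝ)
    (hc0 : c 0 = 0) (hc1 : c 1 = 0)
    (hcpos : ∀ n, 0 ≤ c n) (hcne : ∃ n, c n ≠ 0)
    -- `f` converges absolutely in some half-plane:
    (hfconv : {σ : ℝ | Summable fun n : ℕ => c n * (n : ℝ) ^ (-σ)}.Nonempty)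
    -- the abscissa of absolute convergence of `f` is finite (`σ_a^f > -∞`):
    (hffin : BddBelow {σ : ℝ | Summable fun n : ℕ => c n * (n : ℝ) ^ (-σ)})
    -- `σf` is the abscissa of absolute convergence of `f`:
    (σf : ℝ) (hσf : σf = sInf {σ : ℝ | Summable fun n : ℕ => c n * (n : ℝ) ^ (-σ)})
    (w : ℝ) (hw : 0 < w)
    -- `g` is the solution of `f(s - w·g(s)) = g(s)`:
    (b : ℕ → ℂ) (hb0 : b 0 = 0) (hb1 : b 1 = 0)
    (hgconv : ∃ θ : ℝ, ∀ s : ℂ, θ < s.re → Summable fun n : ℕ => ‖b n * (n : ℂ) ^ (-s)‖)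
    (heq : ∃ θ : ℝ, ∀ s : ℂ, θ < s.re →
      DSeries (fun n => (c n : ℂ)) (s - (w : ℂ) * DSeries b s) = DSeries b s)
    -- `σg` is the abscissa of absolute convergence of `g`:
    (σg : ℝ) (hσg : σg = sInf {σ : ℝ | Summable fun n : ℕ => ‖b n‖ * (n : ℝ) ^ (-σ)})
    -- `f` and its derivative `f'` on the real axis:
    (f f' : ℝ → ℝ)
    (hf : ∀ s : ℝ, f s = ∑' n : ℕ, c n * (n : ℝ) ^ (-s))
    (hf' : ∀ s : ℝ, f' s = -∑' n : ℕ, c n * Real.log n * (n : ℝ) ^ (-s))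
    -- `L` is the (possibly `-∞`) right limit `lim_{s → σf+} f'(s)`:
    (L : EReal)
    (hL : Filter.Tendsto (fun s : ℝ => ((f' s : ℝ) : EReal))
      (nhdsWithin σf (Set.Ioi σf)) (nhds L)) :
    (L < ((-1 / w : ℝ) : EReal) →
      (∃! s₀ : ℝ, σf < s₀ ∧ f' s₀ = -1 / w) ∧
      ∀ s₀ : ℝ, σf < s₀ → f' s₀ = -1 / w → σg = s₀ + w * f s₀) ∧
    (((-1 / w : ℝ) : EReal) ≤ L →
      (Summable fun n : ℕ => c n * (n : ℝ) ^ (-σf)) ∧ σg = σf + w * f σf) := by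
  have hS := Sg_eq c hc0 hc1 hcpos hfconv w hw b hb0 hgconv heq
  simp_rw [← hf] at hS
  -- below any `s > σf` there is a point of convergence
  have hbelow : ∀ s, σf < s → ∃ t, t < s ∧ Summable fun n : ℕ => c n * (n : ℝ) ^ (-t) := by
    intro s hs
    rw [hσf] at hs
    obtain ⟨t, ht, hts⟩ := exists_lt_of_csInf_lt hfconv hs
    exact ⟨t, hts, ht⟩
  have hsum : ∀ s, σf < s → Summable fun n : ℕ => c n * (n : ℝ) ^ (-s) := by
    intro s hs
    obtain ⟨t, hts, ht⟩ := hbelow s hs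
    exact summable_up c hc0 hcpos hts.le ht
  have hsumlog : ∀ s, σf < s → Summable fun n : ℕ => c n * Real.log n * (n : ℝ) ^ (-s) := by
    intro s hs
    obtain ⟨t, hts, ht⟩ := hbelow s hs
    exact summable_log c hc0 hcpos hts ht
  have hlow : ∀ u, (Summable fun n : ℕ => c n * (n : ℝ) ^ (-u)) → σf ≤ u := by
    intro u hu
    rw [hσf]
    exact csInf_le hffin hu
  have hlog0 : ∀ n, 0 ≤ c n * Real.log n := fun n =>
    mul_nonneg (hcpos n) (Real.log_natCast_nonneg n)
  -- minimisation gives the abscissa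
  have hmin : ∀ s, (Summable fun n : ℕ => c n * (n : ℝ) ^ (-s)) →
      (Summable fun n : ℕ => c n * Real.log n * (n : ℝ) ^ (-s)) →
      (∀ u, (Summable fun n : ℕ => c n * (n : ℝ) ^ (-u)) → 0 ≤ (1 + w * f' s) * (u - s)) →
      σg = s + w * f s := by
    intro s h1 h2 h3
    rw [hσg]
    refine IsLeast.csInf_eq ⟨?_, ?_⟩
    · exact (hS _).mpr ⟨s, h1, le_rfl⟩
    · intro σ hσ
      obtain ⟨u, hu, hle⟩ := (hS σ).mp hσ
      have ht := tangent c hc0 hcpos s u h1 h2 hu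
      rw [← hf, ← hf] at ht
      have h4 := h3 u hu
      rw [hf' s] at h4
      nlinarith [mul_le_mul_of_nonneg_left ht hw.le]
  -- strict monotonicity
  obtain ⟨N, hN⟩ := hcne
  have hNpos : 0 < c N := lt_of_le_of_ne (hcpos N) (Ne.symm hN)
  have hN2 : 2 ≤ N := by
    by_contra h
    have : N = 0 ∨ N = 1 := by omega
    rcases this with rfl | rfl
    · exact hN hc0
    · exact hN hc1
  have hmono : ∀ s u, σf < s → s < u → f' s < f' u := by
    intro s u hs hsu
    rw [hf', hf', neg_lt_neg_iff]
    refine Summable.tsum_lt_tsum (i := N) (fun n => ?_) ?_ (hsumlog u (hs.trans hsu)) (hsumlog s hs)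
    · rcases eq_or_ne n 0 with rfl | hn
      · simp
      refine mul_le_mul_of_nonneg_left ?_ (hlog0 n)
      refine Real.rpow_le_rpow_of_exponent_le ?_ (by linarith)
      exact_mod_cast Nat.one_le_iff_ne_zero.mpr hn
    · have hN1 : (1 : ℝ) < N := by exact_mod_cast hN2
      refine mul_lt_mul_of_pos_left ?_ (mul_pos hNpos (Real.log_pos hN1))
      exact Real.rpow_lt_rpow_of_exponent_lt hN1 (by linarith)
  constructor
  · intro hLw
    -- a point with `f' < -1/w`
    obtain ⟨s₁, hs₁, hs₁'⟩ : ∃ s₁, σf < s₁ ∧ f' s₁ < -1 / w := by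
      have h1 := hL.eventually (gt_mem_nhds hLw)
      obtain ⟨s, h2, h3⟩ := (h1.and self_mem_nhdsWithin).exists
      exact ⟨s, h3, by exact_mod_cast h2⟩
    -- a point with `f' > -1/w`
    obtain ⟨s₂, hs₂, hs₂'⟩ : ∃ s₂, s₁ ≤ s₂ ∧ -1 / w < f' s₂ := by
      have hb : ∀ t, 0 ≤ t → f' s₁ * (2 : ℝ) ^ (-t) ≤ f' (s₁ + t) := by
        intro t ht
        rw [hf', hf', neg_mul, neg_le_neg_iff, ← tsum_mul_right]
        refine Summable.tsum_le_tsum (fun n => ?_) (hsumlog _ (by linarith))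
          ((hsumlog s₁ hs₁).mul_right _)
        rcases lt_or_ge n 2 with hn | hn
        · have : n = 0 ∨ n = 1 := by omega
          rcases this with rfl | rfl <;> simp
        have hn' : (0 : ℝ) < n := by positivity
        have hn2 : (2 : ℝ) ≤ n := by exact_mod_cast hn
        rw [neg_add, Real.rpow_add hn', ← mul_assoc]
        refine mul_le_mul_of_nonneg_left ?_ (mul_nonneg (hlog0 n) (by positivity))
        exact Real.rpow_le_rpow_of_nonpos (by norm_num) hn2 (by linarith)
      have hlim : Filter.Tendsto (fun t : ℝ => f' s₁ * (2 : ℝ) ^ (-t)) Filter.atTop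
          (nhds (f' s₁ * 0)) := by
        refine Filter.Tendsto.const_mul _ ?_
        have h5 := (tendsto_rpow_atTop_of_base_gt_one (2 : ℝ) (by norm_num)).inv_tendsto_atTop
        refine h5.congr fun t => ?_
        simp [Real.rpow_neg]
      rw [mul_zero] at hlim
      have hneg : -1 / w < 0 := div_neg_of_neg_of_pos (by norm_num) hw
      obtain ⟨t, h6, h7⟩ := ((hlim.eventually (lt_mem_nhds hneg)).and
        (Filter.eventually_ge_atTop 0)).exists
      exact ⟨s₁ + t, by linarith, h6.trans_le (hb t h7)⟩
    have hcont : ContinuousOn f' (Set.Icc s₁ s₂) := by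
      have : f' = fun s => -∑' n : ℕ, c n * Real.log n * (n : ℝ) ^ (-s) := funext hf'
      rw [this]
      refine ContinuousOn.neg ?_
      refine continuousOn_tsum (u := fun n : ℕ => c n * Real.log n * (n : ℝ) ^ (-s₁)) ?_
        (hsumlog s₁ hs₁) ?_
      · intro n
        rcases eq_or_ne n 0 with rfl | hn
        · simp only [hc0, zero_mul]; exact continuousOn_const
        have hn' : (n : ℝ) ≠ 0 := by positivity
        refine Continuous.continuousOn ?_
        exact continuous_const.mul (Continuous.rpow continuous_const continuous_neg
          (fun _ => Or.inl hn'))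
      · intro n s hs
        rw [Real.norm_of_nonneg (mul_nonneg (hlog0 n) (by positivity))]
        rcases eq_or_ne n 0 with rfl | hn
        · simp
        refine mul_le_mul_of_nonneg_left ?_ (hlog0 n)
        refine Real.rpow_le_rpow_of_exponent_le ?_ (by linarith [hs.1])
        exact_mod_cast Nat.one_le_iff_ne_zero.mpr hn
    obtain ⟨s₀, hs₀, hs₀'⟩ := intermediate_value_Icc hs₂ hcont ⟨hs₁'.le, hs₂'.le⟩
    refine ⟨⟨s₀, ⟨hs₁.trans_le hs₀.1, hs₀'⟩, ?_⟩, ?_⟩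
    · rintro s ⟨hs, hs'⟩
      rcases lt_trichotomy s s₀ with h | h | h
      · have := hmono s s₀ hs h; linarith
      · exact h
      · have := hmono s₀ s (hs₁.trans_le hs₀.1) h; linarith
    · intro s hs hs'
      refine hmin s (hsum s hs) (hsumlog s hs) fun u _ => ?_
      have : 1 + w * f' s = 0 := by rw [hs']; field_simp; ring
      rw [this, zero_mul]
  · intro hLw
    have hge : ∀ s, σf < s → -1 / w ≤ f' s := by
      intro s hs
      have h1 : L ≤ ((f' s : ℝ) : EReal) := by
        refine le_of_tendsto hL ?_
        filter_upwards [self_mem_nhdsWithin, mem_nhdsWithin_of_mem_nhds (gt_mem_nhds hs)] with t ht ht'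
        exact_mod_cast (hmono t s ht ht').le
      exact_mod_cast hLw.trans h1
    have hpart : ∀ F : Finset ℕ, ∑ n ∈ F, c n * Real.log n * (n : ℝ) ^ (-σf) ≤ 1 / w := by
      intro F
      have hc : Filter.Tendsto (fun s : ℝ => ∑ n ∈ F, c n * Real.log n * (n : ℝ) ^ (-s))
          (nhdsWithin σf (Set.Ioi σf)) (nhds (∑ n ∈ F, c n * Real.log n * (n : ℝ) ^ (-σf))) := by
        refine tendsto_finset_sum _ fun n _ => ?_
        rcases eq_or_ne n 0 with rfl | hn
        · simp
        have hn' : (n : ℝ) ≠ 0 := by positivity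
        have : Continuous fun s : ℝ => c n * Real.log n * (n : ℝ) ^ (-s) :=
          continuous_const.mul (Continuous.rpow continuous_const continuous_neg
            (fun _ => Or.inl hn'))
        exact this.continuousAt.continuousWithinAt
      refine le_of_tendsto hc ?_
      filter_upwards [self_mem_nhdsWithin] with s hs
      have h1 := hge s hs
      rw [hf'] at h1
      have h2 := (hsumlog s hs).sum_le_tsum F (fun n _ => mul_nonneg (hlog0 n) (by positivity))
      have h3 : -1 / w = -(1 / w) := by ring
      linarith
    have hsl : Summable fun n : ℕ => c n * Real.log n * (n : ℝ) ^ (-σf) :=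
      summable_of_sum_le (fun n => mul_nonneg (hlog0 n) (by positivity)) hpart
    have hs : Summable fun n : ℕ => c n * (n : ℝ) ^ (-σf) := by
      refine Summable.of_nonneg_of_le (fun n => mul_nonneg (hcpos n) (by positivity)) (fun n => ?_)
        (hsl.mul_left (1 / Real.log 2))
      have hl2 : 0 < Real.log 2 := Real.log_pos (by norm_num)
      rcases lt_or_ge n 2 with hn | hn
      · have : n = 0 ∨ n = 1 := by omega
        rcases this with rfl | rfl <;> simp [hc0, hc1]
      have hn2 : (2 : ℝ) ≤ n := by exact_mod_cast hn
      have hl : Real.log 2 ≤ Real.log n := Real.log_le_log (by norm_num) hn2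
      have h1 : 1 ≤ 1 / Real.log 2 * Real.log n := by
        rw [one_div, inv_mul_eq_div, le_div_iff₀ hl2]; linarith
      have h2 : 0 ≤ c n * (n : ℝ) ^ (-σf) := mul_nonneg (hcpos n) (by positivity)
      calc c n * (n : ℝ) ^ (-σf) ≤ (1 / Real.log 2 * Real.log n) * (c n * (n : ℝ) ^ (-σf)) :=
            le_mul_of_one_le_left h2 h1
        _ = _ := by ring
    refine ⟨hs, hmin σf hs hsl fun u hu => ?_⟩
    refine mul_nonneg ?_ (sub_nonneg.mpr (hlow u hu))
    have h1 : ∑' n : ℕ, c n * Real.log n * (n : ℝ) ^ (-σf) ≤ 1 / w := hsl.tsum_le_of_sum_le hpart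
    rw [hf']
    have h2 := mul_le_mul_of_nonneg_left h1 hw.le
    rw [mul_one_div_cancel hw.ne'] at h2
    linarith
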